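/- Every abelian return word of a factor of a Sturmian word is either a single letter or of the form aBb, where a and b are distinct letters and B is a bispecial factor of the Sturmian word. -/

import Mathlib

variable {α : Type*}

/-- The factor of the infinite word `w` of length `n` starting at position `i`. -/
def factorAt (w : ℕ → α) (i n : ℕ) : List α :=
  (List.range n).map fun k => w (i + k)

/-- `u` is a factor of the infinite word `w`. -/
def IsFactor (w : ℕ → α) (u : List α) : Prop :=
  ∃ i, factorAt w i u.length = u

/-- `w` is recurrent: each of its factors occurs infinitely many times. -/
def Recurrent (w : ℕ → α) : Prop :=
  ∀ u : List α, IsFactor w u → ∀ N : ℕ, ∃ i, N ≤ i ∧ factorAt w i u.length = u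

/-- `w` is periodic: there is `T > 0` with `w (n + T) = w n` for all `n`. -/
def Periodic (w : ℕ → α) : Prop :=
  ∃ T : ℕ, 0 < T ∧ ∀ n, w (n + T) = w n

def Aperiodic (w : ℕ → α) : Prop := ¬ Periodic w

def UltimatelyPeriodic (w : ℕ → α) : Prop :=
  ∃ N T : ℕ, 0 < T ∧ ∀ n, N ≤ n → w (n + T) = w n

/-- `w` is Sturmian: aperiodic with subword complexity `n + 1`. -/
def Sturmian (w : ℕ → α) : Prop :=
  Aperiodic w ∧ ∀ n : ℕ, {u : List α | u.length = n ∧ IsFactor w u}.ncard = n + 1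

/-- Positions where `u` occurs in `w`. -/
def Occurrences (w : ℕ → α) (u : List α) : Set ℕ :=
  {i | factorAt w i u.length = u}

/-- The return words of `u` in `w`: words from one occurrence of `u` to the next. -/
def ReturnWords (w : ℕ → α) (u : List α) : Set (List α) :=
  {r | ∃ i j : ℕ, i ∈ Occurrences w u ∧ j ∈ Occurrences w u ∧ i < j ∧
    (∀ k, i < k → k < j → k ∉ Occurrences w u) ∧ r = factorAt w i (j - i)}

/-- Positions where a word abelian-equivalent to `u` occurs in `w`. -/
def AbelianOccurrences (w : ℕ → α) (u : List α) : Set ℕ :=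
  {i | List.Perm (factorAt w i u.length) u}

/-- The abelian return words of `u` in `w`. -/
def AbelianReturnWords (w : ℕ → α) (u : List α) : Set (List α) :=
  {r | ∃ i j : ℕ, i ∈ AbelianOccurrences w u ∧ j ∈ AbelianOccurrences w u ∧ i < j ∧
    (∀ k, i < k → k < j → k ∉ AbelianOccurrences w u) ∧ r = factorAt w i (j - i)}

/-- The abelian equivalence classes (as multisets) of the abelian return words of `u` in `w`. -/
def abelianReturnClasses (w : ℕ → α) (u : List α) : Set (Multiset α) :=
  (fun r : List α => (r : Multiset α)) '' AbelianReturnWords w u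

def RightSpecial (w : ℕ → α) (u : List α) : Prop :=
  ∃ a b : α, a ≠ b ∧ IsFactor w (u ++ [a]) ∧ IsFactor w (u ++ [b])

def LeftSpecial (w : ℕ → α) (u : List α) : Prop :=
  ∃ a b : α, a ≠ b ∧ IsFactor w (a :: u) ∧ IsFactor w (b :: u)

def Bispecial (w : ℕ → α) (u : List α) : Prop :=
  RightSpecial w u ∧ LeftSpecial w u

/-- A factor is singular if it is the only factor of `w` in its abelian class. -/
def Singular (w : ℕ → α) (u : List α) : Prop :=
  ∀ v : List α, IsFactor w v → List.Perm v u → v = u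

/-- `w` is an infinite concatenation of words from `S`. -/
def InfConcat (S : Set (List α)) (w : ℕ → α) : Prop :=
  ∃ f : ℕ → List α, (∀ n, f n ∈ S) ∧
    ∀ n, factorAt w (((List.range n).map fun k => (f k).length).sum) (f n).length = f n

/-- A finite binary word is balanced if any two factors of equal length have numbers
of occurrences of `true` differing by at most one. -/
def BalancedList (w : List Bool) : Prop :=
  ∀ u v : List Bool, u <:+: w → v <:+: w → u.length = v.length →
    |(u.count true : ℤ) - (v.count true : ℤ)| ≤ 1

section Factors

variable {w : ℕ → α}

theorem length_factorAt (w : ℕ → α) (i n : ℕ) : (factorAt w i n).length = n := by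
  simp [factorAt]

theorem isFactor_factorAt (w : ℕ → α) (i n : ℕ) : IsFactor w (factorAt w i n) :=
  ⟨i, by rw [length_factorAt]⟩

theorem factorAt_eq_iff {i j n : ℕ} :
    factorAt w i n = factorAt w j n ↔ ∀ k < n, w (i + k) = w (j + k) := by
  simp [factorAt]

theorem factorAt_add (w : ℕ → α) (i m n : ℕ) :
    factorAt w i (m + n) = factorAt w i m ++ factorAt w (i + m) n := by
  simp [factorAt, List.range_add, Function.comp_def, add_assoc]

theorem factorAt_succ (w : ℕ → α) (i n : ℕ) :
    factorAt w i (n + 1) = factorAt w i n ++ [w (i + n)] := by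
  rw [factorAt_add]
  simp [factorAt]

theorem factorAt_succ' (w : ℕ → α) (i n : ℕ) :
    factorAt w i (n + 1) = w i :: factorAt w (i + 1) n := by
  rw [add_comm n 1, factorAt_add]
  simp [factorAt]

theorem factorAt_succ_eq_iff {i j n : ℕ} :
    factorAt w i (n + 1) = factorAt w j (n + 1) ↔
      factorAt w i n = factorAt w j n ∧ w (i + n) = w (j + n) := by
  simp only [factorAt_eq_iff]
  grind

theorem factorAt_succ_eq_iff' {i j n : ℕ} :
    factorAt w i (n + 1) = factorAt w j (n + 1) ↔
      w i = w j ∧ factorAt w (i + 1) n = factorAt w (j + 1) n := by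
  simp [factorAt_succ']

theorem setOf_isFactor_eq_range (w : ℕ → α) (n : ℕ) :
    {u : List α | u.length = n ∧ IsFactor w u} = Set.range fun i => factorAt w i n := by
  ext u
  constructor
  · rintro ⟨rfl, i, hi⟩
    exact ⟨i, hi⟩
  · rintro ⟨i, rfl⟩
    exact ⟨length_factorAt w i n, isFactor_factorAt w i n⟩

end Factors

section Sturmian

variable {w : ℕ → Bool}

theorem Sturmian.ncard_range (hw : Sturmian w) (n : ℕ) :
    (Set.range fun i => factorAt w i n).ncard = n + 1 := by
  rw [← setOf_isFactor_eq_range, hw.2 n]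

theorem Sturmian.finite_range (hw : Sturmian w) (n : ℕ) :
    (Set.range fun i => factorAt w i n).Finite :=
  Set.finite_of_ncard_ne_zero (by rw [hw.ncard_range]; omega)

theorem Sturmian.not_ultimatelyPeriodic (hw : Sturmian w) : ¬ UltimatelyPeriodic w := by
  rintro ⟨N, T, hT, h⟩
  have key : ∀ i, ∃ j < N + T, factorAt w i (N + T) = factorAt w j (N + T) := by
    intro i
    induction i using Nat.strong_induction_on with
    | _ i ih =>
      by_cases hi : i < N + T
      · exact ⟨i, hi, rfl⟩
      · obtain ⟨j, hj, hij⟩ := ih (i - T) (by omega)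
        refine ⟨j, hj, hij ▸ factorAt_eq_iff.2 fun k _ => ?_⟩
        rw [← h (i - T + k) (by omega)]
        congr 1
        omega
  have hsub : (Set.range fun i => factorAt w i (N + T)) ⊆
      (fun i => factorAt w i (N + T)) '' (Finset.range (N + T) : Set ℕ) := by
    rintro _ ⟨i, rfl⟩
    obtain ⟨j, hj, hij⟩ := key i
    exact ⟨j, by simpa using hj, hij.symm⟩
  have h1 := Set.ncard_le_ncard hsub ((Finset.finite_toSet _).image _)
  have h2 := Set.ncard_image_le (f := fun i => factorAt w i (N + T))
    (Finset.finite_toSet (Finset.range (N + T)))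
  rw [hw.ncard_range] at h1
  rw [Set.ncard_coe_finset, Finset.card_range] at h2
  omega

/-- A Sturmian word has a right special factor of each length. -/
theorem Sturmian.exists_rightSpecial (hw : Sturmian w) (n : ℕ) :
    ∃ a b, factorAt w a n = factorAt w b n ∧ w (a + n) ≠ w (b + n) := by
  by_contra! h
  have hsub : (Set.range fun i => factorAt w i n).ncard ≥
      (Set.range fun i => factorAt w i (n + 1)).ncard := by
    refine Set.ncard_le_ncard_of_injOn (List.take n) ?_ ?_ (hw.finite_range n)
    · rintro _ ⟨i, rfl⟩
      exact ⟨i, by simp [factorAt_succ, length_factorAt]⟩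
    · rintro _ ⟨i, rfl⟩ _ ⟨j, rfl⟩ hij
      have hij' : factorAt w i n = factorAt w j n := by
        simpa [factorAt_succ, length_factorAt] using hij
      exact factorAt_succ_eq_iff.2 ⟨hij', h i j hij'⟩
  rw [hw.ncard_range, hw.ncard_range] at hsub
  omega

/-- A Sturmian word has at most one right special factor of each length. -/
theorem Sturmian.rightSpecial_unique (hw : Sturmian w) {n a b c d : ℕ}
    (hab : factorAt w a n = factorAt w b n) (hab' : w (a + n) ≠ w (b + n))
    (hcd : factorAt w c n = factorAt w d n) (hcd' : w (c + n) ≠ w (d + n)) :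
    factorAt w a n = factorAt w c n := by
  by_contra hac
  set F := Set.range fun i => factorAt w i (n + 1)
  have hfin : F.Finite := hw.finite_range (n + 1)
  have hne : factorAt w a (n + 1) ≠ factorAt w c (n + 1) := fun h =>
    hac (factorAt_succ_eq_iff.1 h).1
  have hcard : (F \ {factorAt w a (n + 1), factorAt w c (n + 1)}).ncard + 2 = n + 2 := by
    have hpair : {factorAt w a (n + 1), factorAt w c (n + 1)} ⊆ F := by
      rintro _ (rfl | rfl)
      exacts [⟨a, rfl⟩, ⟨c, rfl⟩]
    rw [← Set.ncard_pair hne, Set.ncard_sdiff_add_ncard_of_subset hpair hfin, hw.ncard_range,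
      Set.ncard_pair hne]
  have hsub : (Set.range fun i => factorAt w i n) ⊆
      List.take n '' (F \ {factorAt w a (n + 1), factorAt w c (n + 1)}) := by
    rintro _ ⟨i, rfl⟩
    have htake : ∀ j, List.take n (factorAt w j (n + 1)) = factorAt w j n := fun j => by
      simp [factorAt_succ, length_factorAt]
    have hmem : ∀ j, factorAt w j n = factorAt w i n →
        factorAt w j (n + 1) ≠ factorAt w a (n + 1) →
        factorAt w j (n + 1) ≠ factorAt w c (n + 1) →
        factorAt w i n ∈ List.take n '' (F \ {factorAt w a (n + 1), factorAt w c (n + 1)}) :=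
      fun j hj h1 h2 => ⟨factorAt w j (n + 1), ⟨⟨j, rfl⟩, by simp [h1, h2]⟩, (htake j).trans hj⟩
    by_cases hia : factorAt w i (n + 1) = factorAt w a (n + 1)
    · have := (factorAt_succ_eq_iff.1 hia).1
      refine hmem b (by rw [this, hab]) (fun h => hab' (factorAt_succ_eq_iff.1 h).2.symm)
        fun h => hac (hab.trans (factorAt_succ_eq_iff.1 h).1)
    by_cases hic : factorAt w i (n + 1) = factorAt w c (n + 1)
    · have := (factorAt_succ_eq_iff.1 hic).1
      refine hmem d (by rw [this, hcd])
        (fun h => hac ((factorAt_succ_eq_iff.1 h).1.symm.trans hcd.symm))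
        fun h => hcd' (factorAt_succ_eq_iff.1 h).2.symm
    exact hmem i rfl hia hic
  have h1 := Set.ncard_le_ncard hsub (hfin.sdiff.image _)
  have h2 := Set.ncard_image_le (f := List.take n)
    (hfin.sdiff (t := {factorAt w a (n + 1), factorAt w c (n + 1)}))
  rw [hw.ncard_range] at h1
  omega

/-- The right special factor of length `n` of a Sturmian word occurs in every window of
`n + 1` consecutive positions. -/
theorem Sturmian.exists_rightSpecial_occurrence (hw : Sturmian w) {n a b : ℕ} (hn : 0 < n)
    (hab : factorAt w a n = factorAt w b n) (hab' : w (a + n) ≠ w (b + n)) (x : ℕ) :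
    ∃ k ≤ n, factorAt w (x + k) n = factorAt w a n := by
  by_contra! hx
  obtain ⟨k, l, hkl, hl, heq⟩ : ∃ k l, k < l ∧ l ≤ n ∧
      factorAt w (x + k) n = factorAt w (x + l) n := by
    by_contra! h
    have hinj : Set.InjOn (fun k => factorAt w (x + k) n) (Finset.range (n + 1) : Set ℕ) := by
      intro k hk l hl hkl
      simp only [Finset.coe_range, Set.mem_Iio] at hk hl
      rcases lt_trichotomy k l with hlt | rfl | hlt
      · exact absurd hkl (h k l hlt (by omega))
      · rfl
      · exact absurd hkl.symm (h l k hlt (by omega))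
    have hcard := hinj.ncard_image
    rw [Set.ncard_coe_finset, Finset.card_range] at hcard
    have hsub : (fun k => factorAt w (x + k) n) '' (Finset.range (n + 1) : Set ℕ) ⊆
        (Set.range fun i => factorAt w i n) \ {factorAt w a n} := by
      rintro _ ⟨k, hk, rfl⟩
      simp only [Finset.coe_range, Set.mem_Iio] at hk
      exact ⟨⟨x + k, rfl⟩, hx k (by omega)⟩
    have h1 := Set.ncard_le_ncard hsub (hw.finite_range n).sdiff
    have h2 := Set.ncard_sdiff_singleton_lt_of_mem
      (show factorAt w a n ∈ Set.range fun i => factorAt w i n from ⟨a, rfl⟩) (hw.finite_range n)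
    rw [hw.ncard_range] at h2
    omega
  have step : ∀ c d, factorAt w c n = factorAt w d n → factorAt w c n ≠ factorAt w a n →
      factorAt w (c + 1) n = factorAt w (d + 1) n := by
    intro c d hcd hca
    have : w (c + n) = w (d + n) := by
      by_contra hne
      exact hca (hw.rightSpecial_unique hcd hne hab hab')
    exact (factorAt_succ_eq_iff'.1 (factorAt_succ_eq_iff.2 ⟨hcd, this⟩)).2
  have key : ∀ m, factorAt w (x + k + m) n = factorAt w (x + l + m) n ∧
      factorAt w (x + k + m) n ≠ factorAt w a n := by
    intro m
    induction m using Nat.strong_induction_on with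
    | _ m ih =>
      constructor
      · cases m with
        | zero => exact heq
        | succ m => exact step _ _ (ih m (by omega)).1 (ih m (by omega)).2
      · by_cases hm : m < l - k
        · rw [add_assoc]
          exact hx _ (by omega)
        · obtain ⟨h1, h2⟩ := ih (m - (l - k)) (by omega)
          rwa [h1, show x + l + (m - (l - k)) = x + k + m by omega] at h2
  refine hw.not_ultimatelyPeriodic ⟨x + k, l - k, by omega, fun m hm => ?_⟩
  have := factorAt_eq_iff.1 (key (m - (x + k))).1 0 hn
  rw [show x + k + (m - (x + k)) + 0 = m by omega,
    show x + l + (m - (x + k)) + 0 = m + (l - k) by omega] at this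
  exact this.symm

theorem count_true_factorAt_add (w : ℕ → Bool) (i m n : ℕ) :
    (factorAt w i (m + n)).count true =
      (factorAt w i m).count true + (factorAt w (i + m) n).count true := by
  rw [factorAt_add, List.count_append]

theorem count_true_factorAt_one (w : ℕ → Bool) (i : ℕ) :
    (factorAt w i 1).count true = (w i).toNat := by
  cases h : w i <;> simp [factorAt, h]

theorem Sturmian.no_palindromic_pair (hw : Sturmian w) {n x y : ℕ} (hn : 0 < n)
    (hR : ∃ b, factorAt w y n = factorAt w b n ∧ w (y + n) ≠ w (b + n))
    (hxy : w x ≠ w y) (h : ∀ k, 0 < k → k < n → w (x + k) = w (y + k))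
    (hpal : ∀ k ≤ n, w (x + k) = w (x + (n - k))) : False := by
  obtain ⟨b, hb, hb'⟩ := hR
  obtain ⟨k, hk, hky⟩ := hw.exists_rightSpecial_occurrence hn hb hb' x
  rw [factorAt_eq_iff] at hky
  have h0 : w (x + k) = w y := hky 0 hn
  have hend : w (x + n) = w x := (hpal 0 (by omega)).symm
  rcases Nat.eq_zero_or_pos k with rfl | hk0
  · exact hxy h0
  rcases hk.eq_or_lt with rfl | hkn
  · exact hxy (hend.symm.trans h0)
  have h1 := hky (n - k) (by omega)
  rw [show x + k + (n - k) = x + n by omega, hend, ← h (n - k) (by omega) (by omega),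
    ← hpal k hk, h0] at h1
  exact hxy h1

/-- Sturmian words are balanced. -/
theorem Sturmian.count_true_le (hw : Sturmian w) (n i j : ℕ) :
    (factorAt w i n).count true ≤ (factorAt w j n).count true + 1 := by
  induction n using Nat.strong_induction_on generalizing i j with
  | _ N ih =>
    by_contra! hlt
    set c : ℕ → ℕ → ℕ := fun i n => (factorAt w i n).count true with hc
    have hadd : ∀ i m n, c i (m + n) = c i m + c (i + m) n := count_true_factorAt_add w
    have hone : ∀ i, c i 1 = (w i).toNat := count_true_factorAt_one w
    have hzero : ∀ i, c i 0 = 0 := fun i => rfl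
    have hlt : c j N + 1 < c i N := hlt
    have hbal : ∀ n < N, ∀ i j, c i n ≤ c j n + 1 := ih
    have hinj : Function.Injective Bool.toNat := by decide
    have hN : 2 ≤ N := by
      by_contra! h
      obtain rfl | rfl : N = 0 ∨ N = 1 := by omega
      · simp [hzero] at hlt
      · rw [hone, hone] at hlt
        have := Bool.toNat_le (w i)
        omega
    have hpre : ∀ k, 0 < k → k < N → c i k = c j k + 1 := by
      intro k hk hkN
      have h1 := hadd i k (N - k)
      have h2 := hadd j k (N - k)
      rw [show k + (N - k) = N by omega] at h1 h2
      have := hbal k hkN i j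
      have := hbal (N - k) (by omega) (i + k) (j + k)
      omega
    have htot : c i N = c j N + 2 := by
      have h1 := hadd i 1 (N - 1)
      have h2 := hadd j 1 (N - 1)
      rw [show 1 + (N - 1) = N by omega] at h1 h2
      have := hbal 1 (by omega) i j
      have := hbal (N - 1) (by omega) (i + 1) (j + 1)
      omega
    have hsymm : ∀ k ≤ N, c i k + c i (N - k) = c i N := by
      intro k hk
      rcases Nat.eq_zero_or_pos k with rfl | hk0
      · simp [hzero]
      rcases hk.eq_or_lt with rfl | hkN
      · simp [hzero]
      have h1 := hadd i (N - k) k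
      have h2 := hadd j (N - k) k
      rw [show N - k + k = N by omega] at h1 h2
      have := hpre k hk0 hkN
      have := hpre (N - k) (by omega) (by omega)
      have := hbal k hkN i (j + (N - k))
      have := hbal k hkN (i + (N - k)) j
      omega
    have hsucc : ∀ i k, c i (k + 1) = c i k + (w (i + k)).toNat := fun i k => by
      rw [hadd, hone]
    obtain ⟨n, rfl⟩ : ∃ n, N = n + 1 := ⟨N - 1, by omega⟩
    have hij : w i ≠ w j := by
      intro h
      have := hpre 1 (by omega) (by omega)
      rw [hone, hone, h] at this
      omega
    have hmid : ∀ k, 0 < k → k < n → w (i + k) = w (j + k) := by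
      intro k hk hkn
      apply hinj
      have h1 := hpre k hk (by omega)
      have h2 := hpre (k + 1) (by omega) (by omega)
      rw [hsucc, hsucc] at h2
      omega
    have hpali : ∀ k ≤ n, w (i + k) = w (i + (n - k)) := by
      intro k hk
      apply hinj
      have h1 := hsymm k (by omega)
      have h2 := hsymm (k + 1) (by omega)
      rw [show n + 1 - k = n - k + 1 by omega, hsucc i (n - k)] at h1
      rw [show n + 1 - (k + 1) = n - k by omega, hsucc] at h2
      omega
    have hend : w (i + n) ≠ w (j + n) := by
      intro h
      have := hpre n (by omega) (by omega)
      rw [hsucc, hsucc, h] at htot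
      omega
    have hpalj : ∀ k ≤ n, w (j + k) = w (j + (n - k)) := by
      intro k hk
      rcases Nat.eq_zero_or_pos k with rfl | hk0
      · have h0 : w i = w (i + n) := hpali 0 (by omega)
        have hj : w j = w (j + n) := by
          revert hij hend h0
          cases w i <;> cases w j <;> cases w (i + n) <;> cases w (j + n) <;> decide
        simpa using hj
      rcases hk.eq_or_lt with rfl | hkn
      · have h0 : w i = w (i + k) := hpali 0 (by omega)
        have hj : w (j + k) = w j := by
          revert hij hend h0
          cases w i <;> cases w j <;> cases w (i + k) <;> cases w (j + k) <;> decide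
        simpa using hj
      rw [← hmid k hk0 hkn, ← hmid (n - k) (by omega) (by omega), hpali k hk]
    obtain ⟨m, rfl⟩ : ∃ m, n = m + 1 := ⟨n - 1, by omega⟩
    obtain ⟨a, b, hab, hab'⟩ := hw.exists_rightSpecial (m + 1)
    have hij' : factorAt w (i + 1) m = factorAt w (j + 1) m := by
      rw [factorAt_eq_iff]
      intro k hk
      have := hmid (k + 1) (by omega) (by omega)
      rwa [show i + 1 + k = i + (k + 1) by omega, show j + 1 + k = j + (k + 1) by omega]
    have hai : factorAt w (a + 1) m = factorAt w (i + 1) m := by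
      refine hw.rightSpecial_unique (factorAt_succ_eq_iff'.1 hab).2 ?_ hij' ?_
      · rwa [add_right_comm a, add_right_comm b]
      · rwa [add_right_comm i, add_right_comm j]
    have hspecial : ∀ y, factorAt w a (m + 1) = factorAt w y (m + 1) →
        ∃ b, factorAt w y (m + 1) = factorAt w b (m + 1) ∧ w (y + (m + 1)) ≠ w (b + (m + 1)) := by
      intro y hy
      by_cases hya : w (y + (m + 1)) = w (a + (m + 1))
      · exact ⟨b, hy.symm.trans hab, hya ▸ hab'⟩
      · exact ⟨a, hy.symm, hya⟩
    by_cases hwa : w a = w i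
    · exact hw.no_palindromic_pair (by omega)
        (hspecial i (factorAt_succ_eq_iff'.2 ⟨hwa, hai⟩)) hij.symm
        (fun k h1 h2 => (hmid k h1 h2).symm) hpalj
    · have hwa' : w a = w j := by
        revert hwa hij
        cases w a <;> cases w i <;> cases w j <;> decide
      exact hw.no_palindromic_pair (by omega)
        (hspecial j (factorAt_succ_eq_iff'.2 ⟨hwa', hai.trans hij'⟩)) hij hmid hpali

end Sturmian

theorem mem_abelianOccurrences_iff {w : ℕ → Bool} {u : List Bool} {i : ℕ} :
    i ∈ AbelianOccurrences w u ↔ (factorAt w i u.length).count true = u.count true := by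
  refine ⟨fun h => List.Perm.count_eq h true, fun h => List.perm_iff_count.2 ?_⟩
  have h1 := List.count_not_add_count (factorAt w i u.length) true
  have h2 := List.count_not_add_count u true
  rw [length_factorAt] at h1
  rintro (_ | _)
  · simp only [Bool.not_true] at h1 h2
    omega
  · exact h

/-- Every abelian return word of a factor of a Sturmian word is either a
single letter or of the form `aBb` with `a ≠ b` letters and `B` a bispecial factor. -/
theorem abelian_return_letter_or_aBb (w : ℕ → Bool) (hw : Sturmian w)
    (u : List Bool) (hu : IsFactor w u)
    (r : List Bool) (hr : r ∈ AbelianReturnWords w u) :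
    (∃ a : Bool, r = [a]) ∨
    (∃ (a b : Bool) (B : List Bool), a ≠ b ∧ Bispecial w B ∧ r = a :: (B ++ [b])) := by
  obtain ⟨i, j, hi, hj, hij, hbetween, rfl⟩ := hr
  obtain rfl | ⟨l, rfl⟩ : j = i + 1 ∨ ∃ l, j = i + (l + 2) :=
    (Nat.lt_or_ge (i + 1) j).symm.imp (fun h => by omega) fun h => ⟨j - i - 2, by omega⟩
  · exact Or.inl ⟨w i, by simp [factorAt]⟩
  right
  simp only [mem_abelianOccurrences_iff] at hi hj hbetween
  set n := u.length
  have hinj : Function.Injective Bool.toNat := by decide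
  have hsucc : ∀ k, (factorAt w k n).count true + (w (k + n)).toNat =
      (w k).toNat + (factorAt w (k + 1) n).count true := by
    intro k
    have h1 := count_true_factorAt_add w k n 1
    have h2 := count_true_factorAt_add w k 1 n
    rw [count_true_factorAt_one] at h1 h2
    rw [add_comm 1 n] at h2
    omega
  have hconst : ∀ k, i < k → k < i + (l + 2) →
      (factorAt w k n).count true = (factorAt w (i + 1) n).count true := by
    intro k h1 h2
    have := hbetween k h1 h2
    have := hbetween (i + 1) (by omega) (by omega)
    have := hw.count_true_le n k i
    have := hw.count_true_le n i k
    have := hw.count_true_le n (i + 1) i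
    have := hw.count_true_le n i (i + 1)
    have := hw.count_true_le n k (i + 1)
    have := hw.count_true_le n (i + 1) k
    omega
  have hmid : factorAt w (i + n + 1) l = factorAt w (i + 1) l := by
    refine factorAt_eq_iff.2 fun k hk => hinj ?_
    have h1 := hsucc (i + 1 + k)
    rw [hconst (i + 1 + k) (by omega) (by omega),
      hconst (i + 1 + k + 1) (by omega) (by omega)] at h1
    rw [show i + n + 1 + k = i + 1 + k + n by omega]
    omega
  have hfirst := hsucc i
  have hlast := hsucc (i + 1 + l)
  rw [hconst (i + 1 + l) (by omega) (by omega),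
    show i + 1 + l + 1 = i + (l + 2) by omega, hj] at hlast
  rw [hi] at hfirst
  have hne := hbetween (i + 1) (by omega) (by omega)
  have hstart : w i ≠ w (i + n) := fun h => by
    rw [← h] at hfirst
    omega
  have hend : w (i + 1 + l) ≠ w (i + 1 + l + n) := fun h => by
    rw [← h] at hlast
    omega
  have hends : w i ≠ w (i + 1 + l) := by
    intro h
    rw [← h] at hlast hend
    have : w (i + n) = w (i + 1 + l + n) := by
      revert hstart hend
      cases w i <;> cases w (i + n) <;> cases w (i + 1 + l + n) <;> decide
    rw [← this] at hlast
    omega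
  refine ⟨w i, w (i + 1 + l), factorAt w (i + 1) l, hends, ⟨?_, ?_⟩, ?_⟩
  · refine ⟨w (i + 1 + l), w (i + 1 + l + n), hend, ?_, ?_⟩
    · rw [← factorAt_succ]
      exact isFactor_factorAt w _ _
    · rw [← hmid, show i + 1 + l + n = i + n + 1 + l by omega, ← factorAt_succ]
      exact isFactor_factorAt w _ _
  · refine ⟨w i, w (i + n), hstart, ?_, ?_⟩
    · rw [← factorAt_succ']
      exact isFactor_factorAt w _ _
    · rw [← hmid, ← factorAt_succ']
      exact isFactor_factorAt w _ _
  · rw [← factorAt_succ, ← factorAt_succ', Nat.add_sub_cancel_left]
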